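/- For a Markov chain choice model, let r ∈ {2,…,n−1}, fix i ∈ N and S_∩ ⊆ N \ {i} with |S_∩| = r − 1, and let 𝒮 := { S_∩ ∪ {k} : k ∈ N \ (S_∩ ∪ {i}) }. Then dim(Span ⋃_{S∈𝒮} { h_{j,S} : j ∈ S₊ }) ≥ n, where h_{j,S} := (π(j, S | k))_{k∈N₊} ∈ ℝ^{n+1}. -/

import Mathlib

open Matrix Filter Finset

/-- The product-by-product submatrix `ρ̃` of the transition matrix
(rows/columns indexed by the products `1,…,n`, i.e. the nonzero states). -/
def subRho {n : ℕ} (rho : Matrix (Fin (n+1)) (Fin (n+1)) ℝ) : Matrix (Fin n) (Fin n) ℝ :=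
  Matrix.of fun i j => rho i.succ j.succ

/-- Markov chain choice model: `lam` is a probability vector on the states `{0,1,…,n}`,
`rho` is row-stochastic, state `0` (no purchase) is absorbing, there are no self-loops on
product states, and the product-by-product submatrix `ρ̃` is irreducible. -/
def IsMCCM {n : ℕ} (lam : Fin (n+1) → ℝ) (rho : Matrix (Fin (n+1)) (Fin (n+1)) ℝ) : Prop :=
  (∀ i, 0 ≤ lam i) ∧ (∑ i, lam i = 1) ∧
  (∀ i j, 0 ≤ rho i j) ∧ (∀ i, ∑ j, rho i j = 1) ∧
  rho 0 0 = 1 ∧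
  (∀ i : Fin (n+1), i ≠ 0 → rho i i = 0) ∧
  (∀ i j : Fin n, ∃ t : ℕ, 1 ≤ t ∧ 0 < (subRho rho ^ t) i j)

/-- `ρ^S`: the transition matrix with every row `i ∈ S` replaced by the `i`-th standard
basis vector, so that all states of `S ∪ {0}` are absorbing. -/
def absorb {n : ℕ} (rho : Matrix (Fin (n+1)) (Fin (n+1)) ℝ) (S : Finset (Fin (n+1))) :
    Matrix (Fin (n+1)) (Fin (n+1)) ℝ :=
  Matrix.of fun i j => if i ∈ S then (if j = i then (1 : ℝ) else 0) else rho i j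

/-- The conditional choice probability `π(j, S ∣ i) := lim_{t→∞} ((ρ^S)^t)_{i,j}`. -/
noncomputable def condProb {n : ℕ} (rho : Matrix (Fin (n+1)) (Fin (n+1)) ℝ)
    (S : Finset (Fin (n+1))) (i j : Fin (n+1)) : ℝ :=
  limUnder atTop fun t : ℕ => (absorb rho S ^ t) i j

/-- The choice probability `π(j, S) := ∑_{k ∈ N₊} λ_k · π(j, S ∣ k)`. -/
noncomputable def choiceProb {n : ℕ} (lam : Fin (n+1) → ℝ)
    (rho : Matrix (Fin (n+1)) (Fin (n+1)) ℝ) (S : Finset (Fin (n+1))) (j : Fin (n+1)) : ℝ :=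
  ∑ k, lam k * condProb rho S k j

/-- The vector `h_{j,S} = (π(j, S ∣ k))_{k ∈ N₊} ∈ ℝ^{n+1}`. -/
noncomputable def hvec {n : ℕ} (rho : Matrix (Fin (n+1)) (Fin (n+1)) ℝ)
    (S : Finset (Fin (n+1))) (j : Fin (n+1)) : Fin (n+1) → ℝ :=
  fun k => condProb rho S k j

/-- The entries of the powers of a stochastic matrix in the column of an absorbing state
converge. -/
theorem tendsto_pow_apply_of_absorbing {ι : Type*} [Fintype ι] [DecidableEq ι]
    {P : Matrix ι ι ℝ} (hP : P ∈ rowStochastic ℝ ι) {j : ι} (hj : P j j = 1) (k : ι) :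
    ∃ a, Tendsto (fun t : ℕ => (P ^ t) k j) atTop (nhds a) := by
  have hpow (t : ℕ) : P ^ t ∈ rowStochastic ℝ ι := pow_mem hP t
  refine ⟨_, tendsto_atTop_ciSup (monotone_nat_of_le_succ fun t => ?_) ⟨1, ?_⟩⟩
  · rw [pow_succ, Matrix.mul_apply]
    calc (P ^ t) k j = (P ^ t) k j * P j j := by rw [hj, mul_one]
      _ ≤ ∑ l, (P ^ t) k l * P l j :=
        Finset.single_le_sum (f := fun l => (P ^ t) k l * P l j)
          (fun l _ => mul_nonneg (nonneg_of_mem_rowStochastic (hpow t))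
            (nonneg_of_mem_rowStochastic hP)) (Finset.mem_univ j)
  · rintro _ ⟨t, rfl⟩
    exact le_one_of_mem_rowStochastic (hpow t)

theorem pow_apply_of_row_eq_one {ι : Type*} [Fintype ι] [DecidableEq ι] {P : Matrix ι ι ℝ}
    {k : ι} (hk : ∀ j, P k j = (1 : Matrix ι ι ℝ) k j) (t : ℕ) (j : ι) :
    (P ^ t) k j = (1 : Matrix ι ι ℝ) k j := by
  induction t with
  | zero => simp
  | succ t ih =>
    rw [pow_succ', Matrix.mul_apply]
    simp [hk, Matrix.one_apply, ih]

section MCCM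

variable {n : ℕ} {lam : Fin (n+1) → ℝ} {rho : Matrix (Fin (n+1)) (Fin (n+1)) ℝ}

theorem IsMCCM.mem_rowStochastic (h : IsMCCM lam rho) : rho ∈ rowStochastic ℝ (Fin (n+1)) :=
  mem_rowStochastic_iff_sum.2 ⟨h.2.2.1, h.2.2.2.1⟩

theorem IsMCCM.row_zero (h : IsMCCM lam rho) (j : Fin (n+1)) :
    rho 0 j = (1 : Matrix (Fin (n+1)) (Fin (n+1)) ℝ) 0 j := by
  obtain ⟨-, -, hnn, hsum, h00, -⟩ := h
  rcases eq_or_ne j 0 with rfl | hj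
  · simpa using h00
  · rw [Matrix.one_apply_ne hj.symm]
    have h1 := hsum 0
    rw [← Finset.add_sum_erase _ _ (Finset.mem_univ (0 : Fin (n+1))), h00] at h1
    have h2 : ∑ x ∈ Finset.univ.erase (0 : Fin (n+1)), rho 0 x = 0 := by linarith
    exact (Finset.sum_eq_zero_iff_of_nonneg fun x _ => hnn 0 x).1 h2 j (by simp [hj])

theorem absorb_apply_of_mem (h : IsMCCM lam rho) {S : Finset (Fin (n+1))} {k : Fin (n+1)}
    (hk : k ∈ insert 0 S) (j : Fin (n+1)) :
    absorb rho S k j = (1 : Matrix (Fin (n+1)) (Fin (n+1)) ℝ) k j := by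
  by_cases hkS : k ∈ S
  · simp [absorb, hkS, Matrix.one_apply, eq_comm]
  · obtain rfl : k = 0 := by simpa [hkS] using hk
    simpa [absorb, hkS] using h.row_zero j

theorem absorb_mem_rowStochastic (h : IsMCCM lam rho) (S : Finset (Fin (n+1))) :
    absorb rho S ∈ rowStochastic ℝ (Fin (n+1)) := by
  refine mem_rowStochastic_iff_sum.2 ⟨fun k j => ?_, fun k => ?_⟩
  · have := h.2.2.1 k j
    simp only [absorb, Matrix.of_apply]
    split_ifs <;> simp [this]
  · by_cases hk : k ∈ S
    · simp [absorb, hk]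
    · simpa [absorb, hk] using h.2.2.2.1 k

theorem tendsto_absorb_pow (h : IsMCCM lam rho) {S : Finset (Fin (n+1))} {j : Fin (n+1)}
    (hj : j ∈ insert 0 S) (k : Fin (n+1)) :
    Tendsto (fun t : ℕ => (absorb rho S ^ t) k j) atTop (nhds (hvec rho S j k)) := by
  obtain ⟨a, ha⟩ := tendsto_pow_apply_of_absorbing (absorb_mem_rowStochastic h S)
    ((absorb_apply_of_mem h hj j).trans (Matrix.one_apply_eq j)) k
  rwa [hvec, condProb, ha.limUnder_eq]

theorem hvec_apply_of_mem (h : IsMCCM lam rho) {S : Finset (Fin (n+1))} {j k : Fin (n+1)}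
    (hj : j ∈ insert 0 S) (hk : k ∈ insert 0 S) :
    hvec rho S j k = (1 : Matrix (Fin (n+1)) (Fin (n+1)) ℝ) k j := by
  refine tendsto_nhds_unique (tendsto_absorb_pow h hj k) ?_
  simp_rw [pow_apply_of_row_eq_one (absorb_apply_of_mem h hk)]
  exact tendsto_const_nhds

/-- `h_{j,S}` is harmonic for `ρ` outside of `S`. -/
theorem mulVec_hvec_apply (h : IsMCCM lam rho) {S : Finset (Fin (n+1))} {j k : Fin (n+1)}
    (hj : j ∈ insert 0 S) (hk : k ∉ S) :
    (rho *ᵥ hvec rho S j) k = hvec rho S j k := by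
  refine tendsto_nhds_unique ?_ ((tendsto_add_atTop_iff_nat 1).2 (tendsto_absorb_pow h hj k))
  simp_rw [pow_succ', Matrix.mul_apply]
  have hrow (l : Fin (n+1)) : absorb rho S k l = rho k l := by simp [absorb, hk]
  simp_rw [hrow]
  exact tendsto_finsetSum _ fun l _ => (tendsto_absorb_pow h hj l).const_mul _

/-- Maximum principle: a function harmonic off `T` and vanishing on `T` is nowhere positive. -/
theorem nonpos_of_harmonic (h : IsMCCM lam rho) {T : Finset (Fin (n+1))} (h0 : 0 ∈ T)
    {s : Fin (n+1)} (hs0 : s ≠ 0) (hs : s ∈ T) {f : Fin (n+1) → ℝ}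
    (hf0 : ∀ k ∈ T, f k = 0) (hf : ∀ k ∉ T, (rho *ᵥ f) k = f k) (x : Fin (n+1)) : f x ≤ 0 := by
  obtain ⟨-, -, hnn, hsum, -, -, hirr⟩ := h
  obtain ⟨m, hm⟩ := Finite.exists_max f
  by_contra! hx
  have hM : 0 < f m := hx.trans_le (hm x)
  have hstep {a b : Fin (n+1)} (ha : f a = f m) (hab : 0 < rho a b) : f b = f m := by
    have haT : a ∉ T := fun haT => by
      have := hf0 a haT
      linarith
    have hz : ∑ l, rho a l * (f m - f l) = 0 := by
      have := hf a haT
      simp only [Matrix.mulVec, dotProduct] at this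
      simp only [mul_sub, Finset.sum_sub_distrib, ← Finset.sum_mul, hsum, this, ha]
      ring
    have := (Finset.sum_eq_zero_iff_of_nonneg fun l _ =>
      mul_nonneg (hnn a l) (sub_nonneg.2 (hm l))).1 hz b (Finset.mem_univ b)
    rcases mul_eq_zero.1 this with h1 | h1 <;> linarith
  have hsub0 (a b : Fin n) : 0 ≤ subRho rho a b := hnn _ _
  have hreach (t : ℕ) : ∀ a b : Fin n, f a.succ = f m → 0 < (subRho rho ^ t) a b →
      f b.succ = f m := by
    induction t with
    | zero =>
      intro a b ha hab
      rcases eq_or_ne a b with rfl | hne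
      · exact ha
      · simp [Matrix.one_apply_ne hne] at hab
    | succ t ih =>
      intro a b ha hab
      rw [pow_succ', Matrix.mul_apply] at hab
      obtain ⟨l, -, hl⟩ := Finset.exists_lt_of_sum_lt
        (s := Finset.univ) (f := fun _ : Fin n => (0 : ℝ)) (by simpa using hab)
      have h1 : 0 < subRho rho a l :=
        (hsub0 a l).lt_of_ne fun h => by simp [← h] at hl
      exact ih l b (hstep ha h1) (pos_of_mul_pos_right hl h1.le)
  have hm0 : m ≠ 0 := fun hm0 => by
    rw [hm0, hf0 0 h0] at hM
    exact hM.false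
  obtain ⟨a, rfl⟩ := Fin.exists_succ_eq.2 hm0
  obtain ⟨b, rfl⟩ := Fin.exists_succ_eq.2 hs0
  obtain ⟨t, -, ht⟩ := hirr a b
  have := hreach t a b rfl ht
  rw [hf0 _ hs] at this
  exact hM.ne this

theorem eq_zero_of_harmonic (h : IsMCCM lam rho) {T : Finset (Fin (n+1))} (h0 : 0 ∈ T)
    {s : Fin (n+1)} (hs0 : s ≠ 0) (hs : s ∈ T) {f : Fin (n+1) → ℝ}
    (hf0 : ∀ k ∈ T, f k = 0) (hf : ∀ k ∉ T, (rho *ᵥ f) k = f k) : f = 0 := by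
  funext x
  refine le_antisymm (nonpos_of_harmonic h h0 hs0 hs hf0 hf x) ?_
  have := nonpos_of_harmonic h h0 hs0 hs (f := -f) (fun k hk => by simp [hf0 k hk])
    (fun k hk => by simp [Matrix.mulVec_neg, hf k hk]) x
  simpa using this

/-- Functions harmonic outside of `S ∪ {0}` are combinations of the `h_{j,S}`. -/
theorem eq_sum_hvec_of_harmonic (h : IsMCCM lam rho) {S : Finset (Fin (n+1))}
    {s : Fin (n+1)} (hs0 : s ≠ 0) (hs : s ∈ S) {f : Fin (n+1) → ℝ}
    (hf : ∀ k ∉ insert 0 S, (rho *ᵥ f) k = f k) :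
    f = ∑ j ∈ insert 0 S, f j • hvec rho S j := by
  refine sub_eq_zero.1 (eq_zero_of_harmonic h (Finset.mem_insert_self 0 S) hs0
    (Finset.mem_insert_of_mem hs) (fun k hk => ?_) fun k hk => ?_)
  · have hval : ∑ j ∈ insert 0 S, f j * hvec rho S j k = ∑ j ∈ insert 0 S,
        f j * (1 : Matrix (Fin (n+1)) (Fin (n+1)) ℝ) k j :=
      Finset.sum_congr rfl fun j hj => by rw [hvec_apply_of_mem h hj hk]
    simp only [Pi.sub_apply, Finset.sum_apply, Pi.smul_apply, smul_eq_mul, hval,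
      Matrix.one_apply, mul_ite, mul_one, mul_zero, Finset.sum_ite_eq, if_pos hk, sub_self]
  · have hkS : k ∉ S := fun hkS => hk (Finset.mem_insert_of_mem hkS)
    rw [Matrix.mulVec_sub, Pi.sub_apply, Pi.sub_apply, hf k hk, Matrix.mulVec_sum]
    simp only [Finset.sum_apply, Matrix.mulVec_smul, Pi.smul_apply]
    congr 1
    exact Finset.sum_congr rfl fun j hj => by rw [mulVec_hvec_apply h hj hkS]

end MCCM

/-- (General case.)  Let `r ∈ {2,…,n−1}`, fix a product `i` and
`S_∩ ⊆ N \ {i}` with `|S_∩| = r − 1`, and let `𝒮 = {S_∩ ∪ {k} : k ∈ N \ (S_∩ ∪ {i})}`.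
Then `dim Span(⋃_{S ∈ 𝒮} {h_{j,S} : j ∈ S₊}) ≥ n` in `ℝ^{n+1}`. -/
theorem mccm_dim_assortment_choice_general {n : ℕ} (hn : 2 ≤ n)
    (lam : Fin (n+1) → ℝ) (rho : Matrix (Fin (n+1)) (Fin (n+1)) ℝ)
    (h : IsMCCM lam rho)
    (r : ℕ) (hr : 2 ≤ r) (hrn : r ≤ n - 1)
    (i : Fin (n+1)) (hi : i ≠ 0)
    (Scap : Finset (Fin (n+1))) (hScap0 : (0 : Fin (n+1)) ∉ Scap)
    (hScapi : i ∉ Scap) (hScapcard : Scap.card = r - 1) :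
    Module.finrank ℝ
      ↥(Submodule.span ℝ
        {x : Fin (n+1) → ℝ | ∃ k : Fin (n+1), k ≠ 0 ∧ k ∉ Scap ∧ k ≠ i ∧
          ∃ j ∈ insert (0 : Fin (n+1)) (insert k Scap),
            x = hvec rho (insert k Scap) j}) ≥ n := by
  set V := Submodule.span ℝ
        {x : Fin (n+1) → ℝ | ∃ k : Fin (n+1), k ≠ 0 ∧ k ∉ Scap ∧ k ≠ i ∧
          ∃ j ∈ insert (0 : Fin (n+1)) (insert k Scap),
            x = hvec rho (insert k Scap) j}
  obtain ⟨s, hs⟩ : Scap.Nonempty := Finset.card_pos.1 (by omega)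
  have hs0 : s ≠ 0 := fun h0 => hScap0 (h0 ▸ hs)
  obtain ⟨k₀, hk₀⟩ : ∃ k, k ∉ insert 0 (insert i Scap) := by
    by_contra! hall
    have h1 := Finset.card_le_card fun k (_ : k ∈ Finset.univ) => hall k
    have h2 := Finset.card_insert_le 0 (insert i Scap)
    have h3 := Finset.card_insert_le i Scap
    rw [Finset.card_univ, Fintype.card_fin] at h1
    omega
  simp only [Finset.mem_insert, not_or] at hk₀
  have hmem {k j : Fin (n+1)} (hk0 : k ≠ 0) (hkS : k ∉ Scap) (hki : k ≠ i)
      (hj : j ∈ insert 0 (insert k Scap)) : hvec rho (insert k Scap) j ∈ V :=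
    Submodule.subset_span ⟨k, hk0, hkS, hki, j, hj, rfl⟩
  let defect : (Fin (n+1) → ℝ) →ₗ[ℝ] (Fin (n+1) → ℝ) := LinearMap.id - rho.mulVecLin
  have defect_apply (f : Fin (n+1) → ℝ) (x : Fin (n+1)) :
      defect f x = f x - (rho *ᵥ f) x := rfl
  -- each `u k` vanishes on `Scap ∪ {0}` and is harmonic at all other states except `k`
  let u (k : Fin (n+1)) : Fin (n+1) → ℝ := hvec rho (insert k Scap) k
  have hku (k : Fin (n+1)) : k ∈ insert 0 (insert k Scap) := by simp
  have hu_defect {k x : Fin (n+1)} (hxS : x ∉ Scap) (hxk : x ≠ k) : defect (u k) x = 0 := by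
    rw [defect_apply, mulVec_hvec_apply h (hku k) (by simp [hxS, hxk]), sub_self]
  have hu_ne {k : Fin (n+1)} (hk0 : k ≠ 0) (hkS : k ∉ Scap) : defect (u k) k ≠ 0 := by
    intro hz
    have hzero : u k = 0 := by
      refine eq_zero_of_harmonic h (Finset.mem_insert_self 0 Scap) hs0
        (Finset.mem_insert_of_mem hs) (fun x hx => ?_) fun x hx => ?_
      · have hxk : x ≠ k := by
          rintro rfl
          simp [hk0, hkS] at hx
        have hx' : x ∈ insert 0 (insert k Scap) := by
          simp only [Finset.mem_insert] at hx ⊢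
          tauto
        exact (hvec_apply_of_mem h (hku k) hx').trans (Matrix.one_apply_ne hxk)
      · refine (sub_eq_zero.1 ?_).symm
        rw [← defect_apply]
        rcases eq_or_ne x k with rfl | hxk
        · exact hz
        · exact hu_defect (fun hxS => hx (Finset.mem_insert_of_mem hxS)) hxk
    have h1 : u k k = 1 :=
      (hvec_apply_of_mem h (hku k) (hku k)).trans (Matrix.one_apply_eq k)
    simp [hzero] at h1
  have hker : LinearMap.ker ((LinearMap.proj i).comp defect) ≤ V := by
    intro f hf
    have hfi : defect f i = 0 := hf
    let K : Finset (Fin (n+1)) := Finset.univ.filter fun k => k ≠ 0 ∧ k ∉ Scap ∧ k ≠ i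
    let g := ∑ k ∈ K, (defect f k / defect (u k) k) • u k
    have hgV : g ∈ V := Submodule.sum_mem _ fun k hk => by
      obtain ⟨hk0, hkS, hki⟩ := (Finset.mem_filter.1 hk).2
      exact Submodule.smul_mem _ _ (hmem hk0 hkS hki (hku k))
    have hg_defect (x : Fin (n+1)) (hx0 : x ≠ 0) (hxS : x ∉ Scap) :
        defect g x = defect f x := by
      have hsum : defect g x =
          ∑ k ∈ K, if k = x then defect f k / defect (u k) k * defect (u k) k else 0 := by
        simp only [g, map_sum, map_smul, Finset.sum_apply, Pi.smul_apply, smul_eq_mul]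
        refine Finset.sum_congr rfl fun k _ => ?_
        split_ifs with hkx
        · rw [hkx]
        · rw [hu_defect hxS (Ne.symm hkx), mul_zero]
      rw [hsum, Finset.sum_ite_eq']
      split_ifs with hxK
      · exact div_mul_cancel₀ _ (hu_ne hx0 hxS)
      · have hxi : x = i := by simpa [K, hx0, hxS] using hxK
        rw [hxi, hfi]
    have hfg : f - g ∈ V := by
      rw [eq_sum_hvec_of_harmonic h (S := insert k₀ Scap) hs0 (Finset.mem_insert_of_mem hs)
        (f := f - g) fun x hx => ?_]
      · exact Submodule.sum_mem _ fun j hj =>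
          Submodule.smul_mem _ _ (hmem hk₀.1 hk₀.2.2 hk₀.2.1 hj)
      · simp only [Finset.mem_insert, not_or] at hx
        refine (sub_eq_zero.1 ?_).symm
        rw [← defect_apply, map_sub, Pi.sub_apply, hg_defect x hx.1 hx.2.2, sub_self]
    simpa using V.add_mem hfg hgV
  have hrank := LinearMap.finrank_range_add_finrank_ker ((LinearMap.proj i).comp defect)
  have hrange := Submodule.finrank_le (LinearMap.range ((LinearMap.proj i).comp defect))
  have hmono := Submodule.finrank_mono hker
  simp only [Module.finrank_fin_fun, Module.finrank_self] at hrank hrange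
  omega
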